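/- arXiv:2603.29714 — 2 statements merged into one kernel-verified Lean document; each statement's English description precedes it below -/
import Mathlib

section
/- Let x, z ∈ P and let φ, ψ : *E_x → *E_z be clean maps. If φ(1_x) = ψ(1_x) (equivalently, φ and ψ agree on S_x), then φ = ψ. -/
open scoped Classical
open MvPolynomial

noncomputable section

variable (K : Type) [Field K]
variable (P : Type) [Fintype P] [PartialOrder P] [OrderBot P]

/-- A finite poset with a least element is *simplicial* if every lower interval
is isomorphic to a boolean algebra (the lattice of all subsets of a finite set). -/
def IsSimplicialPoset : Prop :=
  ∀ x : P, ∃ m : ℕ, Nonempty (Set.Iic x ≃o Finset (Fin m))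

/-- `P* := P \ {0̂}`. -/
abbrev Pstar := {z : P // z ≠ ⊥}

/-- The polynomial ring `S = K[t_z : z ∈ P*]`. -/
abbrev FaceS := MvPolynomial (Pstar P) K

/-- The variable `t_z`, with the convention `t_{0̂} = 1`. -/
def tvar (z : P) : FaceS K P := if h : z = ⊥ then 1 else X ⟨z, h⟩

/-- The set `[a ∨ b]` of minimal elements of the common upper bounds of `a` and `b`. -/
def minUB (a b : P) : Set P :=
  {z | a ≤ z ∧ b ≤ z ∧ ∀ w, a ≤ w → b ≤ w → ¬ w < z}

/-- Minimal elements of the common upper bounds of a set `A`. -/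
def minUBset (A : Set P) : Set P :=
  {z | (∀ a ∈ A, a ≤ z) ∧ ∀ w, (∀ a ∈ A, a ≤ w) → ¬ w < z}

/-- The meet `a ∧ b`, i.e. the largest common lower bound, when it exists (`⊥` otherwise). -/
def pmeet (a b : P) : P :=
  if h : ∃ m, m ≤ a ∧ m ≤ b ∧ ∀ w, w ≤ a → w ≤ b → w ≤ m then h.choose else ⊥

/-- The generator `f_{a,b} = t_a t_b - t_{a ∧ b} ∑_{z ∈ [a ∨ b]} t_z` of the face ideal. -/
def fgen (a b : Pstar P) : FaceS K P :=
  X a * X b - tvar K P (pmeet P a.1 b.1) *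
    ∑ z ∈ (Set.toFinite (minUB P a.1 b.1)).toFinset, tvar K P z

/-- The face ideal `I_P`. -/
def faceIdeal : Ideal (FaceS K P) :=
  Ideal.span (Set.range fun p : Pstar P × Pstar P => fgen K P p.1 p.2)

variable (n : ℕ) (y : Fin n → P)

/-- `y` is an enumeration of the rank one elements (= atoms) of `P`. -/
def AtomEnum : Prop :=
  Function.Injective y ∧ ∀ p : P, IsAtom p ↔ ∃ i, y i = p

/-- The rank of an element: the number of atoms below it. -/
def prank (z : P) : ℕ := (Finset.univ.filter fun i : Fin n => y i ≤ z).card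

/-- The `ℤⁿ`-degree of the variable `t_z`: `deg t_z = ∑_{y_i ≤ z} e_i`. -/
def tdeg (z : Pstar P) : Fin n → ℤ := fun i => if y i ≤ z.1 then 1 else 0

/-- `w = ∑_{z ∈ P*} deg t_z`. -/
def wvec : Fin n → ℤ := fun i => ∑ z : Pstar P, tdeg P n y z i

/-- The degree `d` homogeneous component of `S` for the `ℤⁿ`-grading. -/
def Sgrade (d : Fin n → ℤ) : AddSubgroup (FaceS K P) :=
  (weightedHomogeneousSubmodule K (tdeg P n y) d).toAddSubgroup

/-- The transformed variable `t̃_z` (relative to `x`), with `t̃_{0̂} = 1`. -/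
def ttil (x z : P) : FaceS K P :=
  if z ≤ x ∧ 2 ≤ prank P n y z then
    tvar K P z - ∏ i ∈ Finset.univ.filter fun i : Fin n => y i ≤ z, tvar K P (y i)
  else tvar K P z

/-- The graded prime ideal `p_x = (t_z : z ≰ x) + I_P`. -/
def pIdeal (x : P) : Ideal (FaceS K P) :=
  Ideal.span ((fun z : Pstar P => (X z : FaceS K P)) '' {z | ¬ z.1 ≤ x}) ⊔ faceIdeal K P

/-- The indices of the atoms below `x`. -/
abbrev BelowIx (x : P) := {i : Fin n // y i ≤ x}

/-- `P*_{-x}`: the elements of `P*` which are not atoms below `x`. -/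
abbrev Pmx (x : P) := {z : P // z ≠ ⊥ ∧ ¬ ∃ i : Fin n, y i ≤ x ∧ y i = z}

/-- Index monoid for the "big Laurent" model of `*E_x`. -/
abbrev EIdx (x : P) := (BelowIx P n y x →₀ ℤ) × (Pmx P n y x →₀ ℤ)

/-- The "big Laurent" algebra `K[t_i^{±1} : y_i ≤ x] ⊗_K K[t̃_z^{±1} : z ∈ P*_{-x}]`. -/
abbrev Gx (x : P) := AddMonoidAlgebra K (EIdx P n y x)

/-- Exponent vector of `π_x(t_z) = ∏_{y_i ≤ z} t_i`. -/
def dvec (x : P) (z : P) : BelowIx P n y x →₀ ℤ :=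
  Finsupp.equivFunOnFinite.symm fun i => if y i.1 ≤ z then 1 else 0

/-- The action of `S` on the big Laurent algebra through the comultiplication
`Δ(t_z) = t_z ⊗ 1 + 1 ⊗ t_z`:  the variable `t_z` acts as `π_x(t_z) ⊗ 1 + 1 ⊗ t_z`. -/
def theta (x : P) : FaceS K P →ₐ[K] Gx K P n y x :=
  aeval fun z : Pstar P =>
    (if z.1 ≤ x then AddMonoidAlgebra.single (dvec P n y x z.1, 0) 1 else 0) +
    (if h : ∃ i : Fin n, y i ≤ x ∧ y i = z.1 then 0
     else AddMonoidAlgebra.single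
       ((0 : BelowIx P n y x →₀ ℤ), Finsupp.single (⟨z.1, z.2, h⟩ : Pmx P n y x) (1 : ℤ)) 1)

instance gxModule (x : P) : Module (FaceS K P) (Gx K P n y x) :=
  Module.compHom _ (theta K P n y x).toRingHom

instance gxTower (x : P) : IsScalarTower K (FaceS K P) (Gx K P n y x) := by
  refine ⟨fun k s g => ?_⟩
  show theta K P n y x (k • s) * g = k • (theta K P n y x s * g)
  rw [map_smul, smul_mul_assoc]

instance gxComm (x : P) : SMulCommClass (FaceS K P) K (Gx K P n y x) := by
  refine ⟨fun s k g => ?_⟩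
  show theta K P n y x s * (k • g) = k • (theta K P n y x s * g)
  exact mul_smul_comm k _ g

/-- The submodule by which we quotient the big Laurent algebra to obtain `*E_x`. -/
def Ux (x : P) : Submodule (FaceS K P) (Gx K P n y x) :=
  Submodule.span (FaceS K P)
    {g | ∃ p : EIdx P n y x, (∃ w, 0 < p.2 w) ∧ g = AddMonoidAlgebra.single p 1}

/-- The `ℤⁿ`-graded `S`-module `*E_x = K[t_i^{±1} : y_i ≤ x] ⊗_K K[t_z^{-1} : z ∈ P*_{-x}]`. -/
abbrev ExMod (x : P) := Gx K P n y x ⧸ Ux K P n y x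

instance exComm (x : P) : SMulCommClass (FaceS K P) K (ExMod K P n y x) := by
  refine ⟨fun s k e => ?_⟩
  obtain ⟨g, rfl⟩ := Submodule.Quotient.mk_surjective _ e
  simp only [← Submodule.Quotient.mk_smul]
  rw [smul_comm]

def mIdx (x : P) (a : BelowIx P n y x →₀ ℤ) (b : Pmx P n y x →₀ ℕ) : EIdx P n y x :=
  (a, -Finsupp.mapRange (Nat.cast : ℕ → ℤ) Nat.cast_zero b)

/-- The monomial `∏ t_i^{a_i} ⊗ ∏ t_z^{-b_z}` of `*E_x`. -/
def emono (x : P) (a : BelowIx P n y x →₀ ℤ) (b : Pmx P n y x →₀ ℕ) : ExMod K P n y x :=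
  Submodule.Quotient.mk (AddMonoidAlgebra.single (mIdx P n y x a b) 1)

/-- `1_x = 1 ⊗ 1 ∈ *E_x`. -/
def onex (x : P) : ExMod K P n y x := emono K P n y x 0 0

/-- The `ℤⁿ`-degree of the monomial of `*E_x` with index `p`. -/
def gdeg (x : P) (p : EIdx P n y x) : Fin n → ℤ := fun i =>
  (if h : y i ≤ x then p.1 ⟨i, h⟩ else 0) +
    p.2.sum fun w c => c * (if y i ≤ w.1 then 1 else 0)

/-- The degree `aa` homogeneous component of `*E_x`. -/
def ExGrade (x : P) (aa : Fin n → ℤ) : Submodule K (ExMod K P n y x) :=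
  Submodule.span K
    {e | ∃ p : EIdx P n y x, gdeg P n y x p = aa ∧
      e = Submodule.Quotient.mk (AddMonoidAlgebra.single p 1)}

/-- `L(*E_x)`: the span of the basis monomials with nontrivial second factor and
componentwise nonnegative `ℤⁿ`-degree. -/
def cleanL (x : P) : Submodule K (ExMod K P n y x) :=
  Submodule.span K
    {e | ∃ a b, b ≠ 0 ∧ (∀ i, 0 ≤ gdeg P n y x (mIdx P n y x a b) i) ∧
      e = emono K P n y x a b}

/-- Degree preserving homomorphisms `*E_x → *E_z` (elements of `[*Hom(E_x, E_z)]_0`). -/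
def DegZero (x z : P) (φ : ExMod K P n y x →ₗ[FaceS K P] ExMod K P n y z) : Prop :=
  ∀ aa, ∀ e ∈ ExGrade K P n y x aa, φ e ∈ ExGrade K P n y z aa

/-- Clean homomorphisms `*E_x → *E_z`. -/
def IsClean (x z : P) (φ : ExMod K P n y x →ₗ[FaceS K P] ExMod K P n y z) : Prop :=
  DegZero K P n y x z φ ∧ ∀ e ∈ cleanL K P n y x, φ e ∈ cleanL K P n y z


variable {K P n y}

lemma smul_gx_eq {x : P} (s : FaceS K P) (g : Gx K P n y x) :
    s • g = theta K P n y x s * g := rfl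

lemma smul_mk_eq {x : P} (s : FaceS K P) (g : Gx K P n y x) :
    s • (Submodule.Quotient.mk g : ExMod K P n y x) =
      Submodule.Quotient.mk (theta K P n y x s * g) := rfl

lemma theta_X {x : P} (w : Pstar P) :
    theta K P n y x (X w) =
      (if w.1 ≤ x then AddMonoidAlgebra.single (dvec P n y x w.1, 0) 1 else 0) +
      (if h : ∃ i : Fin n, y i ≤ x ∧ y i = w.1 then 0
       else AddMonoidAlgebra.single
         ((0 : BelowIx P n y x →₀ ℤ),
           Finsupp.single (⟨w.1, w.2, h⟩ : Pmx P n y x) (1 : ℤ)) 1) := by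
  simp [theta]

/-- Elements of the big Laurent algebra whose coefficients vanish at every index with
nonpositive second component. -/
def vanishingNonpos (x : P) : Submodule (FaceS K P) (Gx K P n y x) where
  carrier := {g | ∀ p : EIdx P n y x, p.2 ≤ 0 → g.coeff p = 0}
  add_mem' := by
    intro a b ha hb p hp
    simp [ha p hp, hb p hp]
  zero_mem' := by
    intro p _
    simp
  smul_mem' := by
    intro s
    induction s using MvPolynomial.induction_on with
    | C k =>
      intro g hg p hp
      rw [smul_gx_eq, ← algebraMap_eq, AlgHom.commutes, ← Algebra.smul_def]
      simp [hg p hp]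
    | add s t hs ht =>
      intro g hg p hp
      rw [add_smul]
      simp [hs hg p hp, ht hg p hp]
    | mul_X s w hs =>
      intro g hg
      rw [mul_smul]
      refine hs (fun p hp => ?_)
      have key : ∀ q : EIdx P n y x, 0 ≤ q.2 →
          (AddMonoidAlgebra.single q (1 : K) * g).coeff p = 0 := by
        intro q hq
        rw [AddMonoidAlgebra.coeff_single_mul_apply, hg, mul_zero]
        intro v
        have h1 := hp v
        have h2 := hq v
        simp only [Prod.snd_add, Prod.snd_neg, Finsupp.add_apply, Finsupp.neg_apply,
          Finsupp.coe_zero, Pi.zero_apply] at *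
        omega
      rw [smul_gx_eq, theta_X, add_mul, AddMonoidAlgebra.coeff_add, Finsupp.add_apply]
      have h1 : ∀ v : Pmx P n y x, (0 : Pmx P n y x →₀ ℤ) ≤ Finsupp.single v 1 := by
        intro v
        simp
      have h2 := fun v : Pmx P n y x => key (0, Finsupp.single v 1) (h1 v)
      have h3 := fun a : BelowIx P n y x →₀ ℤ => key (a, 0) le_rfl
      split_ifs
      · rw [h3, zero_mul, AddMonoidAlgebra.coeff_zero, Finsupp.zero_apply, add_zero]
      · rw [h3, h2, add_zero]
      · rw [zero_mul, AddMonoidAlgebra.coeff_zero, Finsupp.zero_apply, add_zero]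
      · rw [zero_mul, h2, AddMonoidAlgebra.coeff_zero, Finsupp.zero_apply, add_zero]

lemma mem_Ux_iff {x : P} (g : Gx K P n y x) :
    g ∈ Ux K P n y x ↔ ∀ p : EIdx P n y x, p.2 ≤ 0 → g.coeff p = 0 := by
  constructor
  · have : Ux K P n y x ≤ vanishingNonpos x := by
      refine Submodule.span_le.2 ?_
      rintro _ ⟨p, ⟨w, hw⟩, rfl⟩ q hq
      rw [AddMonoidAlgebra.coeff_single, Finsupp.single_apply, if_neg]
      rintro rfl
      exact absurd (hq w) (by simpa using hw)
    exact fun hg => this hg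
  · intro hg
    rw [← AddMonoidAlgebra.sum_coeff_single g]
    refine Submodule.sum_mem _ fun p hp => ?_
    have hpos : ∃ w, 0 < p.2 w := by
      by_contra! h
      exact Finsupp.mem_support_iff.1 hp (hg p h)
    have := (Ux K P n y x).smul_mem (C (g.coeff p)) (Submodule.subset_span ⟨p, hpos, rfl⟩)
    rw [smul_gx_eq, ← algebraMap_eq, AlgHom.commutes, ← Algebra.smul_def] at this
    simpa using this

/-- The coefficient functional on `*E_x` at an index with nonpositive second component. -/
def exCoeff {x : P} (q : EIdx P n y x) (hq : q.2 ≤ 0) : ExMod K P n y x →ₗ[K] K :=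
  (Submodule.liftQ ((Ux K P n y x).restrictScalars K)
    (Finsupp.lapply q ∘ₗ (AddMonoidAlgebra.coeffLinearEquiv K).toLinearMap)
    (fun g hg => (mem_Ux_iff g).1 hg q hq)) ∘ₗ
  (Submodule.Quotient.restrictScalarsEquiv K (Ux K P n y x)).symm.toLinearMap

lemma exCoeff_mk {x : P} (q : EIdx P n y x) (hq : q.2 ≤ 0) (g : Gx K P n y x) :
    exCoeff q hq (Submodule.Quotient.mk g) = g.coeff q := rfl

lemma exCoeff_eq_zero_of_mem_ExGrade {x : P} {aa : Fin n → ℤ} {e : ExMod K P n y x}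
    (he : e ∈ ExGrade K P n y x aa) (q : EIdx P n y x) (hq : q.2 ≤ 0)
    (hne : gdeg P n y x q ≠ aa) : exCoeff q hq e = 0 := by
  have : ExGrade K P n y x aa ≤ LinearMap.ker (exCoeff q hq) := by
    refine Submodule.span_le.2 ?_
    rintro _ ⟨p, rfl, rfl⟩
    simp only [SetLike.mem_coe, LinearMap.mem_ker]
    rw [exCoeff_mk, AddMonoidAlgebra.coeff_single, Finsupp.single_apply, if_neg]
    rintro rfl
    exact hne rfl
  exact this he

lemma exCoeff_eq_zero_of_mem_cleanL {x : P} {e : ExMod K P n y x}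
    (he : e ∈ cleanL K P n y x) (q : EIdx P n y x) (hq : q.2 = 0) :
    exCoeff q hq.le e = 0 := by
  have : cleanL K P n y x ≤ LinearMap.ker (exCoeff q hq.le) := by
    refine Submodule.span_le.2 ?_
    rintro _ ⟨a, b, hb, -, rfl⟩
    simp only [SetLike.mem_coe, LinearMap.mem_ker]
    rw [emono, exCoeff_mk, AddMonoidAlgebra.coeff_single, Finsupp.single_apply, if_neg]
    rintro rfl
    apply hb
    ext w
    simpa [mIdx] using DFunLike.congr_fun hq w
  exact this he

lemma single_mem_range_theta (hy : AtomEnum P n y) {x : P} {p : EIdx P n y x} (hp : 0 ≤ p) :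
    ∃ s, theta K P n y x s = AddMonoidAlgebra.single p 1 := by
  let M : AddSubmonoid (EIdx P n y x) :=
    { carrier := {p | ∃ s, theta K P n y x s = AddMonoidAlgebra.single p 1}
      zero_mem' := ⟨1, by rw [map_one]; rfl⟩
      add_mem' := by
        rintro p q ⟨s, hs⟩ ⟨t, ht⟩
        exact ⟨s * t, by rw [map_mul, hs, ht, AddMonoidAlgebra.single_mul_single, one_mul]⟩ }
  have hleft : ∀ i : BelowIx P n y x, ((Finsupp.single i 1, 0) : EIdx P n y x) ∈ M := by
    intro i
    have hatom : IsAtom (y i.1) := (hy.2 _).2 ⟨_, rfl⟩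
    refine ⟨X ⟨y i.1, hatom.1⟩, ?_⟩
    rw [theta_X, if_pos i.2, dif_pos ⟨i.1, i.2, rfl⟩, add_zero]
    congr 2
    ext j
    have : y j.1 ≤ y i.1 ↔ i = j := by
      constructor
      · intro h
        have hj : IsAtom (y j.1) := (hy.2 _).2 ⟨_, rfl⟩
        exact Subtype.ext (hy.1 ((hatom.le_iff_eq hj.1).1 h).symm)
      · rintro rfl
        exact le_rfl
    simp [dvec, this, Finsupp.single_apply]
  have hleft' : ∀ a : BelowIx P n y x →₀ ℤ, 0 ≤ a → ((a, 0) : EIdx P n y x) ∈ M := by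
    intro a ha
    have : ((a, 0) : EIdx P n y x) =
        ∑ i, (a i).toNat • ((Finsupp.single i 1, 0) : EIdx P n y x) := by
      refine Prod.ext ?_ ?_
      · ext j
        simp [Prod.fst_sum, Finsupp.finsetSum_apply, Finsupp.single_apply]
        exact ha j
      · simp [Prod.snd_sum]
    rw [this]
    exact sum_mem fun i _ => nsmul_mem (hleft i) _
  have hright : ∀ w : Pmx P n y x, ((0, Finsupp.single w 1) : EIdx P n y x) ∈ M := by
    intro w
    have hX := theta_X (K := K) (y := y) (x := x) (⟨w.1, w.2.1⟩ : Pstar P)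
    rw [dif_neg w.2.2] at hX
    by_cases h : w.1 ≤ x
    · obtain ⟨s, hs⟩ := hleft' (dvec P n y x w.1) (by
        intro i
        simp only [dvec, Finsupp.coe_zero, Pi.zero_apply, Finsupp.equivFunOnFinite_symm_apply_apply]
        split_ifs <;> simp)
      refine ⟨X ⟨w.1, w.2.1⟩ - s, ?_⟩
      rw [map_sub, hX, hs, if_pos h, add_sub_cancel_left]
    · exact ⟨X ⟨w.1, w.2.1⟩, by rw [hX, if_neg h, zero_add]⟩
  have : p = (p.1, 0) + ∑ w, (p.2 w).toNat • ((0, Finsupp.single w 1) : EIdx P n y x) := by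
    refine Prod.ext ?_ ?_
    · simp [Prod.fst_sum]
    · ext j
      simp [Prod.snd_sum, Finsupp.finsetSum_apply, Finsupp.single_apply]
      exact hp.2 j
  rw [this]
  exact M.add_mem (hleft' _ hp.1) (sum_mem fun i _ => nsmul_mem (hright i) _)

lemma eq_zero_of_exCoeff_smul_eq_zero (hy : AtomEnum P n y) {x : P} (e : ExMod K P n y x)
    (he : ∀ (s : FaceS K P) (a : BelowIx P n y x →₀ ℤ), 0 ≤ a →
      exCoeff (a, 0) le_rfl (s • e) = 0) : e = 0 := by
  obtain ⟨g, rfl⟩ := Submodule.Quotient.mk_surjective _ e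
  refine (Submodule.Quotient.mk_eq_zero _).2 ((mem_Ux_iff g).2 fun p hp => ?_)
  let a : BelowIx P n y x →₀ ℤ := Finsupp.mapRange (fun k : ℤ => |k|) abs_zero p.1
  obtain ⟨s, hs⟩ := single_mem_range_theta (K := K) hy (p := (a, -p.2))
    ⟨fun i => by simp [a], fun w => by simpa using hp w⟩
  have := he s (a + p.1) (fun i => by
    simp only [a, Finsupp.add_apply, Finsupp.mapRange_apply, Finsupp.coe_zero, Pi.zero_apply]
    linarith [neg_abs_le (p.1 i)])
  rw [smul_mk_eq, exCoeff_mk, hs, AddMonoidAlgebra.coeff_single_mul_apply] at this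
  simpa using this

lemma mk_single_eq_zero {x : P} {p : EIdx P n y x} (hp : ¬ p.2 ≤ 0) :
    (Submodule.Quotient.mk (AddMonoidAlgebra.single p 1) : ExMod K P n y x) = 0 := by
  refine (Submodule.Quotient.mk_eq_zero _).2 (Submodule.subset_span ⟨p, ?_, rfl⟩)
  by_contra! h
  exact hp h

/-- Multiplication by a variable sends a basis monomial of `*E_x` to a translate of it in the
left factor, up to a monomial with smaller right factor. -/
lemma X_smul_emono {x : P} (w : Pstar P) (a : BelowIx P n y x →₀ ℤ) (b : Pmx P n y x →₀ ℕ) :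
    ∃ e₁ e₂ : ExMod K P n y x, (X w : FaceS K P) • emono K P n y x a b = e₁ + e₂ ∧
      (e₁ = 0 ∨ ∃ a', e₁ = emono K P n y x a' b) ∧
      (e₂ = 0 ∨ ∃ b' < b, e₂ = emono K P n y x a b') := by
  rw [emono, smul_mk_eq, theta_X, add_mul, Submodule.Quotient.mk_add]
  refine ⟨_, _, rfl, ?_, ?_⟩
  · split_ifs
    · right
      refine ⟨dvec P n y x w.1 + a, ?_⟩
      rw [AddMonoidAlgebra.single_mul_single, one_mul, emono]
      simp [mIdx]
    · left
      rw [zero_mul, Submodule.Quotient.mk_zero]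
  · split_ifs with h
    · left
      rw [zero_mul, Submodule.Quotient.mk_zero]
    · rw [AddMonoidAlgebra.single_mul_single, one_mul]
      set v : Pmx P n y x := ⟨w.1, w.2, h⟩
      by_cases hv : b v = 0
      · left
        apply mk_single_eq_zero
        intro hle
        have := hle v
        simp [mIdx, hv] at this
      · right
        refine ⟨b - Finsupp.single v 1, ?_, ?_⟩
        · refine lt_of_le_of_ne tsub_le_self fun he => ?_
          have := DFunLike.congr_fun he v
          simp at this
          omega
        · rw [emono]
          congr 2
          refine Prod.ext (by simp [mIdx]) ?_
          ext u
          by_cases hu : v = u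
          · subst hu
            simp [mIdx]
            omega
          · simp [mIdx, hu]

lemma sub_apply_emono_zero (hy : AtomEnum P n y) {x z : P}
    {φ ψ : ExMod K P n y x →ₗ[FaceS K P] ExMod K P n y z}
    (h1 : φ (onex K P n y x) = ψ (onex K P n y x))
    {a : BelowIx P n y x →₀ ℤ} (ha : 0 ≤ a) :
    (φ - ψ) (emono K P n y x a 0) = 0 := by
  obtain ⟨s, hs⟩ := single_mem_range_theta (K := K) hy (p := (a, 0)) ⟨ha, le_rfl⟩
  have : emono K P n y x a 0 = s • onex K P n y x := by
    rw [onex, emono, emono, smul_mk_eq, hs, AddMonoidAlgebra.single_mul_single, one_mul]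
    simp [mIdx]
  rw [this, map_smul, LinearMap.sub_apply, h1, sub_self, smul_zero]

variable (K P n y)

/-- Lemma 3.6: two clean maps `φ, ψ : *E_x → *E_z` which agree
on `1_x` (equivalently, on `S_x`) are equal. -/
theorem statement12
    (hP : IsSimplicialPoset P) (hy : AtomEnum P n y) (x z : P)
    (φ ψ : ExMod K P n y x →ₗ[FaceS K P] ExMod K P n y z)
    (hφ : IsClean K P n y x z φ) (hψ : IsClean K P n y x z ψ)
    (h1 : φ (onex K P n y x) = ψ (onex K P n y x)) :
    φ = ψ := by
  have hcoeff : ∀ a b (α : BelowIx P n y z →₀ ℤ), 0 ≤ α →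
      exCoeff (α, 0) le_rfl ((φ - ψ) (emono K P n y x a b)) = 0 := by
    intro a b α hα
    by_cases hd : gdeg P n y z (α, 0) = gdeg P n y x (mIdx P n y x a b)
    · have hnonneg : ∀ i, 0 ≤ gdeg P n y x (mIdx P n y x a b) i := by
        intro i
        rw [← hd]
        simp only [gdeg, Finsupp.sum_zero_index, add_zero]
        split_ifs with h
        · exact hα _
        · exact le_rfl
      by_cases hb : b = 0
      · subst hb
        rw [sub_apply_emono_zero hy h1, map_zero]
        intro i
        simpa [gdeg, mIdx, i.2] using hnonneg i.1
      · have he : emono K P n y x a b ∈ cleanL K P n y x :=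
          Submodule.subset_span ⟨a, b, hb, hnonneg, rfl⟩
        exact exCoeff_eq_zero_of_mem_cleanL (sub_mem (hφ.2 _ he) (hψ.2 _ he)) _ rfl
    · have he : emono K P n y x a b ∈ ExGrade K P n y x (gdeg P n y x (mIdx P n y x a b)) :=
        Submodule.subset_span ⟨_, rfl, rfl⟩
      exact exCoeff_eq_zero_of_mem_ExGrade (sub_mem (hφ.1 _ _ he) (hψ.1 _ _ he)) _ _ hd
  have hmono : ∀ b a, (φ - ψ) (emono K P n y x a b) = 0 := by
    intro b
    induction b using WellFoundedLT.induction with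
    | ind b ih =>
    intro a
    refine eq_zero_of_exCoeff_smul_eq_zero hy _ fun s α hα => ?_
    induction s using MvPolynomial.induction_on generalizing a with
    | C k =>
      rw [← algebraMap_eq, algebraMap_smul, map_smul, hcoeff a b α hα, smul_zero]
    | add s t hs ht => rw [add_smul, map_add, hs, ht, add_zero]
    | mul_X s w hs =>
      obtain ⟨e₁, e₂, he, h₁, h₂⟩ := X_smul_emono (K := K) w a b
      have he₂ : (φ - ψ) e₂ = 0 := by
        rcases h₂ with rfl | ⟨b', hb', rfl⟩
        · exact map_zero _
        · exact ih b' hb' a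
      rw [mul_smul, ← map_smul, he, map_add, he₂, add_zero]
      rcases h₁ with rfl | ⟨a', rfl⟩
      · rw [map_zero, smul_zero, map_zero]
      · exact hs a'
  rw [← sub_eq_zero]
  refine LinearMap.ext fun e => ?_
  obtain ⟨g, rfl⟩ := Submodule.Quotient.mk_surjective _ e
  rw [LinearMap.zero_apply]
  induction g using AddMonoidAlgebra.induction_linear with
  | zero => rw [Submodule.Quotient.mk_zero, map_zero]
  | add g h hg hh => rw [Submodule.Quotient.mk_add, map_add, hg, hh, add_zero]
  | single p k =>
    have hk : (AddMonoidAlgebra.single p k : Gx K P n y x) =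
        (C k : FaceS K P) • AddMonoidAlgebra.single p 1 := by
      rw [smul_gx_eq, ← algebraMap_eq, AlgHom.commutes, ← Algebra.smul_def]
      simp
    rw [hk, Submodule.Quotient.mk_smul, map_smul]
    by_cases hp : p.2 ≤ 0
    · have hidx : p = mIdx P n y x p.1 (Finsupp.mapRange Int.toNat rfl (-p.2)) := by
        refine Prod.ext rfl ?_
        ext w
        have := hp w
        simp only [mIdx, Finsupp.neg_apply, Finsupp.mapRange_apply, Finsupp.coe_zero,
          Pi.zero_apply] at *
        omega
      rw [hidx]
      exact (congrArg _ (hmono _ _)).trans (smul_zero _)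
    · rw [mk_single_eq_zero hp, map_zero, smul_zero]

end
end

section
/- Let x, x' ∈ P* be such that x covers x', with x ∈ [y_1 ∨ ⋯ ∨ y_r] and x' ∈ [y_1 ∨ ⋯ ∨ y_{r−1}]. Set Z := {z ∈ P : z ≤ x, z ≰ x', z ≠ y_r} and W := P* \ (Z ∪ {y_1,…,y_r}). For a basis monomial α = (∏_{i=1}^r t_i^{a_i}) ⊗ t_Z^{−b} t_W^{−c} of *E_x (with b ∈ N^Z, c ∈ N^W) and d ∈ N^Z, let (e_1,…,e_r) ∈ Z^r be determined by π_x(t_Z^d)·∏_{i=1}^r t_i^{a_i} = ∏_{i=1}^r t_i^{e_i} in S_x (π_x : S → S_x the canonical surjection), and set (t_Z^d | α) := ∏_{z∈Z} C(b_z+d_z, b_z) · (∏_{i=1}^{r−1} t_i^{e_i} ⊗ t_Z^{−b−d} t_W^{−c} t_r^{e_r}) ∈ *E_{x'}, interpreted as 0 when e_r > 0 (here C(·,·) is a binomial coefficient). Then the K-linear map ψ : *E_x → *E_{x'} defined on basis monomials by ψ(α) := ∑_{d ∈ N^Z} (t_Z^d | α) (a finite sum) is a degree-preserving S-module homomorphism;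 consequently ψ is a clean map. -/
open scoped Classical
open MvPolynomial

noncomputable section

variable (K : Type) [Field K]
variable (P : Type) [Fintype P] [PartialOrder P] [OrderBot P]

variable (n : ℕ) (y : Fin n → P)

/-- For `z ∈ Z` and `d ∈ ℕ^Z`, the exponents `(e_1, …, e_r)` determined by
`π_x(t_Z^d) ⬝ ∏_{i=1}^r t_i^{a_i} = ∏_{i=1}^r t_i^{e_i}` in `S_x`. -/
def eExp (x : P) (a : BelowIx P n y x →₀ ℤ) (d : Pmx P n y x →₀ ℕ) : Fin n → ℤ :=
  fun i =>
    (if h : y i ≤ x then a ⟨i, h⟩ else 0) +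
      ∑ z ∈ d.support, (d z : ℤ) * (if y i ≤ z.1 then 1 else 0)

/-- The Laurent part `∏_{i=1}^{r-1} t_i^{e_i}` of the target monomial. -/
def leftPart (x x' : P) (a : BelowIx P n y x →₀ ℤ) (d : Pmx P n y x →₀ ℕ) :
    BelowIx P n y x' →₀ ℤ :=
  Finsupp.equivFunOnFinite.symm fun i => eExp P n y x a d i.1

/-- The inclusion `P*_{-x} ↪ P*_{-x'}` (for `x' ≤ x`). -/
def pmxEmb (x x' : P) (hle : x' ≤ x) : Pmx P n y x ↪ Pmx P n y x' where
  toFun z :=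
    ⟨z.1, z.2.1, fun h => z.2.2 (by obtain ⟨i, h1, h2⟩ := h; exact ⟨i, h1.trans hle, h2⟩)⟩
  inj' z w h := Subtype.ext (congrArg Subtype.val h : (_ : P) = _)

/-- The term `(t_Z^d | α) ∈ *E_{x'}`: it is `0` if `e_r > 0` and otherwise equals
`∏_{z ∈ Z} C(b_z + d_z, b_z) ⬝ (∏_{i=1}^{r-1} t_i^{e_i} ⊗ t_Z^{-b-d} t_W^{-c} t_r^{e_r})`
(the binomial coefficients for `z ∉ Z` being equal to `1`, and the exponent of
`t_r = t_{y_{iR}}` in the right-hand factor being `e_r ≤ 0`). -/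
def targetMono (x x' : P) (hle : x' ≤ x) (iR : Fin n) (yb : Pmx P n y x')
    (a : BelowIx P n y x →₀ ℤ) (b d : Pmx P n y x →₀ ℕ) : ExMod K P n y x' :=
  if 0 < eExp P n y x a d iR then 0
  else
    (∏ z ∈ b.support ∪ d.support, Nat.choose (b z + d z) (b z)) •
      emono K P n y x' (leftPart P n y x x' a d)
        (Finsupp.embDomain (pmxEmb P n y x x' hle) (b + d) +
          Finsupp.single yb (-(eExp P n y x a d iR)).toNat)

/-- A bound on the relevant exponent vectors `d ∈ ℕ^Z`: all terms `(t_Z^d | α)`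
with `d ≰ Bnd` vanish (and `(t_Z^d | α) = 0` unless `d` is supported on
`Z = {z ∈ P : z ≤ x, z ≰ x', z ≠ y_r}`). -/
def Bnd (x x' : P) (iR : Fin n) (hyr : y iR ≤ x) (a : BelowIx P n y x →₀ ℤ) :
    Pmx P n y x →₀ ℕ :=
  ∑ z ∈ Finset.univ.filter
      (fun z : Pmx P n y x => z.1 ≤ x ∧ ¬ z.1 ≤ x' ∧ z.1 ≠ y iR),
    Finsupp.single z (-(a ⟨iR, hyr⟩)).toNat

section CoverMap

variable {K : Type} [Field K] {P : Type} [PartialOrder P] [OrderBot P]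
variable {n : ℕ} {y : Fin n → P} {x x' : P}

lemma AtomEnum.eq_of_le (hy : AtomEnum P n y) {i j : Fin n} (h : y i ≤ y j) : i = j := by
  have hj := (hy.2 (y j)).2 ⟨j, rfl⟩
  have hi := (hy.2 (y i)).2 ⟨i, rfl⟩
  exact hy.1 ((hj.le_iff.1 h).resolve_left hi.1)

/-- In a simplicial poset, elements with a common upper bound are compared by the atoms
below them. -/
lemma IsSimplicialPoset.le_of_forall_isAtom (hP : IsSimplicialPoset P) {z w u : P}
    (hz : z ≤ u) (hw : w ≤ u) (h : ∀ a, IsAtom a → a ≤ z → a ≤ w) : z ≤ w := by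
  obtain ⟨m, ⟨e⟩⟩ := hP u
  have key : e ⟨z, hz⟩ ≤ e ⟨w, hw⟩ := by
    intro k hk
    have hs : ({k} : Finset (Fin m)) ≤ e ⟨z, hz⟩ := by simpa using hk
    have ha : IsAtom (e.symm {k}) := by
      rw [OrderIso.isAtom_iff]; exact Finset.isAtom_singleton k
    have ha' : IsAtom (e.symm {k}).1 := by
      refine ⟨fun hb => ha.1 (Subtype.ext hb), fun b hb => ?_⟩
      have := ha.2 ⟨b, hb.le.trans (e.symm {k}).2⟩ hb
      exact congrArg Subtype.val this
    have h1 : (e.symm {k}).1 ≤ z := by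
      have := (e.symm_apply_le (x := ⟨z, hz⟩)).2 hs
      exact this
    have h2 : e.symm {k} ≤ ⟨w, hw⟩ := h _ ha' h1
    have := e.symm_apply_le.1 h2
    exact this (Finset.mem_singleton_self k)
  exact e.le_iff_le.1 key

variable (K P n y) in
/-- The image in `*E_x` of the Laurent monomial with exponent `p`; it vanishes as soon as the
second factor of the monomial has a positive exponent. -/
def exMonomial (x : P) (p : EIdx P n y x) : ExMod K P n y x :=
  Submodule.Quotient.mk (AddMonoidAlgebra.single p 1)

lemma exMonomial_eq_zero {p : EIdx P n y x} {w : Pmx P n y x} (h : 0 < p.2 w) :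
    exMonomial K P n y x p = 0 :=
  (Submodule.Quotient.mk_eq_zero _).2 (Submodule.subset_span ⟨p, ⟨w, h⟩, rfl⟩)

lemma X_smul_exMonomial (z : Pstar P) (p : EIdx P n y x) :
    (X z : FaceS K P) • exMonomial K P n y x p =
      (if z.1 ≤ x then exMonomial K P n y x (p + (dvec P n y x z.1, 0)) else 0) +
      (if h : ∃ i : Fin n, y i ≤ x ∧ y i = z.1 then 0
        else exMonomial K P n y x (p + (0, Finsupp.single ⟨z.1, z.2, h⟩ 1))) := by
  have h : (X z : FaceS K P) • (AddMonoidAlgebra.single p 1 : Gx K P n y x) =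
      theta K P n y x (X z) * AddMonoidAlgebra.single p 1 := rfl
  rw [exMonomial, ← Submodule.Quotient.mk_smul, h, theta, aeval_X, add_mul,
    Submodule.Quotient.mk_add]
  congr 1
  · split_ifs
    · rw [AddMonoidAlgebra.single_mul_single, one_mul, add_comm, exMonomial]
    · rw [zero_mul, Submodule.Quotient.mk_zero]
  · split_ifs
    · rw [zero_mul, Submodule.Quotient.mk_zero]
    · rw [AddMonoidAlgebra.single_mul_single, one_mul, add_comm, exMonomial]

/-- A function on exponents which is compatible with the action of the variables extends to an
`S`-linear map out of `*E_x`. -/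
lemma exists_linearMap_of_exMonomial {N : Type} [AddCommGroup N] [Module (FaceS K P) N]
    (F : EIdx P n y x → N)
    (h0 : ∀ p w, 0 < p.2 w → F p = 0)
    (hF : ∀ (z : Pstar P) p, (X z : FaceS K P) • F p =
      (if z.1 ≤ x then F (p + (dvec P n y x z.1, 0)) else 0) +
      (if h : ∃ i : Fin n, y i ≤ x ∧ y i = z.1 then 0
        else F (p + (0, Finsupp.single ⟨z.1, z.2, h⟩ 1)))) :
    ∃ ψ : ExMod K P n y x →ₗ[FaceS K P] N, ∀ p, ψ (exMonomial K P n y x p) = F p := by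
  let _ : Module K N := Module.compHom N (algebraMap K (FaceS K P))
  have hC : ∀ (k : K) (v : N), (C k : FaceS K P) • v = k • v := fun k v => rfl
  let f : Gx K P n y x →ₗ[K] N :=
    Finsupp.linearCombination K F ∘ₗ (AddMonoidAlgebra.coeffLinearEquiv K).toLinearMap
  have hf : ∀ p k, f (AddMonoidAlgebra.single p k) = k • F p := fun p k =>
    Finsupp.linearCombination_single K k p
  have hX : ∀ (z : Pstar P) (g : Gx K P n y x),
      f ((X z : FaceS K P) • g) = (X z : FaceS K P) • f g := by
    intro z g
    induction g using AddMonoidAlgebra.induction_linear with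
    | zero => simp
    | add a b ha hb => rw [smul_add, map_add, map_add, smul_add, ha, hb]
    | single p k =>
      have h : (X z : FaceS K P) • (AddMonoidAlgebra.single p k : Gx K P n y x) =
          theta K P n y x (X z) * AddMonoidAlgebra.single p k := rfl
      rw [h, theta, aeval_X, add_mul, map_add, hf, ← hC, smul_comm, hF, hC, smul_add]
      congr 1
      · split_ifs
        · rw [AddMonoidAlgebra.single_mul_single, one_mul, add_comm, hf]
        · rw [zero_mul, map_zero, smul_zero]
      · split_ifs
        · rw [zero_mul, map_zero, smul_zero]
        · rw [AddMonoidAlgebra.single_mul_single, one_mul, add_comm, hf]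
  have hS : ∀ (s : FaceS K P) (g : Gx K P n y x), f (s • g) = s • f g := by
    intro s
    induction s using MvPolynomial.induction_on with
    | C k =>
      intro g
      rw [hC, ← map_smul, ← algebraMap_eq, algebraMap_smul]
    | add a b ha hb => intro g; rw [add_smul, map_add, ha, hb, add_smul]
    | mul_X a z ha => intro g; rw [mul_smul, ha, hX, mul_smul]
  let fS : Gx K P n y x →ₗ[FaceS K P] N := { f with map_smul' := hS }
  refine ⟨(Ux K P n y x).liftQ fS (Submodule.span_le.2 ?_), fun p => ?_⟩
  · rintro _ ⟨p, ⟨w, hw⟩, rfl⟩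
    exact (hf p 1).trans (by rw [one_smul, h0 p w hw])
  · exact (hf p 1).trans (one_smul _ _)


section Transport

variable (hle : x' ≤ x) (iR : Fin n) (hyr : y iR ≤ x) (yb : Pmx P n y x')

/-- Exponents of `*E_x` regarded as exponents of `*E_{x'}`: the exponent of `t_r` is moved from
the first to the second tensor factor. -/
def transportIdx : EIdx P n y x →+ EIdx P n y x' where
  toFun p :=
    (Finsupp.equivFunOnFinite.symm fun i => p.1 ⟨i.1, i.2.trans hle⟩,
      Finsupp.mapDomain (pmxEmb P n y x x' hle) p.2 + Finsupp.single yb (p.1 ⟨iR, hyr⟩))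
  map_zero' := by
    ext <;> simp
  map_add' p q := by
    refine Prod.ext ?_ ?_
    · ext; simp
    · simp only [Prod.snd_add, Prod.fst_add, Finsupp.add_apply, Finsupp.mapDomain_add,
        Finsupp.single_add]
      abel

lemma transportIdx_fst (p : EIdx P n y x) (i : BelowIx P n y x') :
    (transportIdx hle iR hyr yb p).1 i = p.1 ⟨i.1, i.2.trans hle⟩ := rfl

lemma transportIdx_snd (p : EIdx P n y x) :
    (transportIdx hle iR hyr yb p).2 =
      Finsupp.mapDomain (pmxEmb P n y x x' hle) p.2 + Finsupp.single yb (p.1 ⟨iR, hyr⟩) := rfl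

variable {hle iR hyr yb}

lemma pmxEmb_ne (hyb : yb.1 = y iR) (hyr : y iR ≤ x) (w : Pmx P n y x) :
    pmxEmb P n y x x' hle w ≠ yb := fun h =>
  w.2.2 ⟨iR, hyr, hyb.symm.trans (congrArg Subtype.val h).symm⟩

lemma transportIdx_snd_pmxEmb (hyb : yb.1 = y iR) (p : EIdx P n y x) (w : Pmx P n y x) :
    (transportIdx hle iR hyr yb p).2 (pmxEmb P n y x x' hle w) = p.2 w := by
  rw [transportIdx_snd, Finsupp.add_apply,
    Finsupp.mapDomain_apply (pmxEmb P n y x x' hle).injective,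
    Finsupp.single_eq_of_ne (pmxEmb_ne hyb hyr w), add_zero]

lemma transportIdx_snd_self (hyb : yb.1 = y iR) (p : EIdx P n y x) :
    (transportIdx hle iR hyr yb p).2 yb = p.1 ⟨iR, hyr⟩ := by
  rw [transportIdx_snd, Finsupp.add_apply, Finsupp.mapDomain_of_notMem_range,
    Finsupp.single_eq_same, zero_add]
  rintro ⟨w, hw⟩
  exact pmxEmb_ne hyb hyr w hw

lemma transportIdx_single (z : Pmx P n y x) (k : ℤ) :
    transportIdx hle iR hyr yb (0, Finsupp.single z k) =
      (0, Finsupp.single (pmxEmb P n y x x' hle z) k) := by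
  refine Prod.ext ?_ ?_
  · ext; rfl
  · rw [transportIdx_snd]; simp [Finsupp.mapDomain_single]

lemma transportIdx_dvec {z : P} (hz : ¬ y iR ≤ z) :
    transportIdx hle iR hyr yb (dvec P n y x z, 0) = (dvec P n y x' z, 0) := by
  refine Prod.ext ?_ ?_
  · ext; rfl
  · rw [transportIdx_snd]; simp [dvec, hz]

lemma transportIdx_dvec_atom (hy : AtomEnum P n y) (hn : ¬ y iR ≤ x') {z : P}
    (hz : y iR = z) :
    transportIdx hle iR hyr yb (dvec P n y x z, 0) = (0, Finsupp.single yb 1) := by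
  subst hz
  refine Prod.ext ?_ ?_
  · ext i
    refine if_neg fun h => hn ?_
    rw [← hy.eq_of_le h]
    exact i.2
  · rw [transportIdx_snd]; simp [dvec]

variable (P n y) in
lemma gdeg_eq_sum [Fintype P] (x : P) (p : EIdx P n y x) (i : Fin n) :
    gdeg P n y x p i = (if h : y i ≤ x then p.1 ⟨i, h⟩ else 0) +
      ∑ w, p.2 w * (if y i ≤ w.1 then 1 else 0) := by
  rw [gdeg, Finsupp.sum_fintype _ _ (fun _ => zero_mul _)]

lemma gdeg_transportIdx (hy : AtomEnum P n y) (hn : ¬ y iR ≤ x')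
    (hi : ∀ i, y i ≤ x → i = iR ∨ y i ≤ x') (hyb : yb.1 = y iR) (p : EIdx P n y x) :
    gdeg P n y x' (transportIdx hle iR hyr yb p) = gdeg P n y x p := by
  funext i
  have h2 : ((transportIdx hle iR hyr yb p).2.sum fun w c => c * (if y i ≤ w.1 then 1 else 0)) =
      (p.2.sum fun w c => c * (if y i ≤ w.1 then 1 else 0)) +
        p.1 ⟨iR, hyr⟩ * (if y i ≤ yb.1 then 1 else 0) := by
    rw [transportIdx_snd, Finsupp.sum_add_index' (fun _ => zero_mul _) (fun _ _ _ => add_mul _ _ _),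
      Finsupp.sum_single_index (zero_mul _),
      Finsupp.sum_mapDomain_index (fun _ => zero_mul _) (fun _ _ _ => add_mul _ _ _)]
    rfl
  rw [gdeg, gdeg, h2, hyb]
  by_cases hir : i = iR
  · subst hir
    rw [dif_neg hn, dif_pos hyr, if_pos le_rfl]
    ring
  · rw [if_neg fun h => hir (hy.eq_of_le h)]
    by_cases hix : y i ≤ x
    · have hix' := (hi i hix).resolve_left hir
      rw [dif_pos hix', dif_pos hix, transportIdx_fst]
      ring
    · rw [dif_neg hix, dif_neg fun h => hix (h.trans hle)]
      ring

end Transport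

section Shift

variable [Fintype P]

/-- The exponent of `π_x(t^d) ⊗ t^{-d}`. -/
def shiftIdx (d : Pmx P n y x →₀ ℕ) : EIdx P n y x :=
  (∑ z, d z • dvec P n y x z.1, -Finsupp.mapRange (Nat.cast : ℕ → ℤ) Nat.cast_zero d)

lemma shiftIdx_snd (d : Pmx P n y x →₀ ℕ) (z : Pmx P n y x) :
    (shiftIdx d).2 z = -(d z : ℤ) := rfl

lemma shiftIdx_fst (d : Pmx P n y x →₀ ℕ) (i : BelowIx P n y x) :
    (shiftIdx d).1 i = ∑ z, (d z : ℤ) * (if y i.1 ≤ z.1 then 1 else 0) := by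
  simp [shiftIdx, Finsupp.finsetSum_apply, dvec]

lemma shiftIdx_add_single (d : Pmx P n y x →₀ ℕ) (z : Pmx P n y x) :
    shiftIdx (d + Finsupp.single z 1) + (0, Finsupp.single z 1) =
      shiftIdx d + (dvec P n y x z.1, 0) := by
  refine Prod.ext ?_ ?_
  · simp [shiftIdx, Finsupp.single_apply, add_smul, Finset.sum_add_distrib, ite_smul]
  · ext w
    simp only [Prod.snd_add, Finsupp.add_apply, shiftIdx_snd]
    by_cases h : z = w
    · subst h; simp
    · simp [h]

lemma gdeg_add_shiftIdx {d : Pmx P n y x →₀ ℕ} (hd : ∀ z, d z ≠ 0 → z.1 ≤ x)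
    (p : EIdx P n y x) : gdeg P n y x (p + shiftIdx d) = gdeg P n y x p := by
  funext i
  rw [gdeg_eq_sum, gdeg_eq_sum]
  simp only [Prod.fst_add, Prod.snd_add, Finsupp.add_apply, shiftIdx_snd, shiftIdx_fst,
    add_mul, Finset.sum_add_distrib, neg_mul, Finset.sum_neg_distrib]
  by_cases h : y i ≤ x
  · simp only [dif_pos h]; ring
  · have : ∑ z, (d z : ℤ) * (if y i ≤ z.1 then 1 else 0) = 0 := by
      refine Finset.sum_eq_zero fun z _ => ?_
      by_cases hz : d z = 0
      · simp [hz]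
      · rw [if_neg fun h' => h (h'.trans (hd z hz)), mul_zero]
    simp only [dif_neg h, this]; ring

/-- The binomial coefficient `C(b + d, b)`, where `b = -q`; it is zero when `b < 0`. -/
def negChoose (q : ℤ) (d : ℕ) : ℕ := if 0 < q then 0 else ((-q).toNat + d).choose (-q).toNat

lemma negChoose_pascal (q : ℤ) (d : ℕ) :
    negChoose q (d + 1) = negChoose q d + negChoose (q + 1) (d + 1) := by
  unfold negChoose
  rcases lt_trichotomy q 0 with h | h | h
  · obtain ⟨k, hk⟩ : ∃ k : ℕ, q = -(k + 1 : ℕ) := ⟨(-q).toNat - 1, by omega⟩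
    rw [if_neg (by omega), if_neg (by omega), if_neg (by omega),
      show (-q).toNat = k + 1 by omega, show (-(q + 1)).toNat = k by omega,
      show k + 1 + (d + 1) = (k + d + 1) + 1 by ring, Nat.choose_succ_succ, add_comm,
      show k + 1 + d = k + d + 1 by ring, add_assoc k]
  · simp [h]
  · rw [if_pos h, if_pos h, if_pos (by omega)]

/-- The coefficient `∏_z C(b_z + d_z, b_z)`, where `b = -q`. -/
def shiftCoeff (q : Pmx P n y x →₀ ℤ) (d : Pmx P n y x →₀ ℕ) : ℕ :=
  ∏ z, negChoose (q z) (d z)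

lemma shiftCoeff_eq_zero {q : Pmx P n y x →₀ ℤ} {w : Pmx P n y x} (hw : 0 < q w)
    (d : Pmx P n y x →₀ ℕ) : shiftCoeff q d = 0 :=
  Finset.prod_eq_zero (Finset.mem_univ w) (if_pos hw)

lemma shiftCoeff_add_single (q : Pmx P n y x →₀ ℤ) {d : Pmx P n y x →₀ ℕ} {z : Pmx P n y x}
    (hz : d z = 0) (hq : q z ≠ 0) : shiftCoeff (q + Finsupp.single z 1) d = shiftCoeff q d := by
  refine Finset.prod_congr rfl fun w _ => ?_
  by_cases h : z = w
  · subst h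
    simp only [Finsupp.add_apply, Finsupp.single_eq_same, hz, negChoose, add_zero,
      Nat.choose_self]
    split_ifs <;> first | rfl | omega
  · simp [h]

lemma shiftCoeff_pascal (q : Pmx P n y x →₀ ℤ) (d : Pmx P n y x →₀ ℕ) (z : Pmx P n y x) :
    shiftCoeff q (d + Finsupp.single z 1) =
      shiftCoeff q d + shiftCoeff (q + Finsupp.single z 1) (d + Finsupp.single z 1) := by
  have h1 : ∀ w ∈ Finset.univ.erase z, (d + Finsupp.single z 1 : Pmx P n y x →₀ ℕ) w = d w := fun w hw => by
    rw [Finsupp.add_apply, Finsupp.single_eq_of_ne (Finset.ne_of_mem_erase hw), add_zero]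
  have h2 : ∀ w ∈ Finset.univ.erase z, (q + Finsupp.single z 1 : Pmx P n y x →₀ ℤ) w = q w := fun w hw => by
    rw [Finsupp.add_apply, Finsupp.single_eq_of_ne (Finset.ne_of_mem_erase hw), add_zero]
  simp only [shiftCoeff, ← Finset.mul_prod_erase _ _ (Finset.mem_univ z)]
  rw [Finset.prod_congr rfl fun w hw => congrArg (negChoose (q w)) (h1 w hw),
    Finset.prod_congr rfl fun w hw => congrArg₂ negChoose (h2 w hw) (h1 w hw), ← add_mul]
  congr 1
  simpa using negChoose_pascal (q z) (d z)

end Shift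

section ShiftSum

variable [Fintype P]

lemma Bnd_apply (iR : Fin n) (hyr : y iR ≤ x) (a : BelowIx P n y x →₀ ℤ) (z : Pmx P n y x) :
    Bnd P n y x x' iR hyr a z =
      if z.1 ≤ x ∧ ¬ z.1 ≤ x' then (-(a ⟨iR, hyr⟩)).toNat else 0 := by
  have hne : z.1 ≠ y iR := fun h => z.2.2 ⟨iR, hyr, h.symm⟩
  rw [Bnd, Finsupp.finsetSum_apply]
  simp only [Finsupp.single_apply]
  rw [Finset.sum_ite_eq']
  simp [hne]

lemma Bnd_anti (iR : Fin n) (hyr : y iR ≤ x) {a a' : BelowIx P n y x →₀ ℤ}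
    (h : a ⟨iR, hyr⟩ ≤ a' ⟨iR, hyr⟩) : Bnd P n y x x' iR hyr a' ≤ Bnd P n y x x' iR hyr a := by
  intro z
  rw [Bnd_apply, Bnd_apply]
  split_ifs <;> omega

lemma Bnd_add_dvec_le (iR : Fin n) (hyr : y iR ≤ x) (a : BelowIx P n y x →₀ ℤ) (z : P) :
    Bnd P n y x x' iR hyr (a + dvec P n y x z) ≤ Bnd P n y x x' iR hyr a := by
  refine Bnd_anti iR hyr (le_add_of_nonneg_right ?_)
  change (0 : ℤ) ≤ if _ then 1 else 0
  split_ifs <;> simp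

lemma Bnd_apply_ne_zero {iR : Fin n} {hyr : y iR ≤ x} {a : BelowIx P n y x →₀ ℤ}
    {z : Pmx P n y x} (h : Bnd P n y x x' iR hyr a z ≠ 0) : z.1 ≤ x ∧ ¬ z.1 ≤ x' := by
  by_contra hz
  exact h (by rw [Bnd_apply, if_neg hz])

lemma ne_zero_of_mem_Iic {α : Type} [DecidableEq α] {B d : α →₀ ℕ} (hd : d ∈ Finset.Iic B)
    {z : α} (hz : d z ≠ 0) : B z ≠ 0 :=
  (lt_of_lt_of_le (Nat.pos_of_ne_zero hz) (Finset.mem_Iic.1 hd z)).ne'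

lemma sum_Iic_add_single {α N : Type} [DecidableEq α] [AddCommMonoid N] (B : α →₀ ℕ) (w : α)
    (f : (α →₀ ℕ) → N) :
    ∑ d ∈ Finset.Iic (B + Finsupp.single w 1), f d =
      ∑ d ∈ (Finset.Iic (B + Finsupp.single w 1)).filter (fun d => d w = 0), f d +
        ∑ d ∈ Finset.Iic B, f (d + Finsupp.single w 1) := by
  rw [← Finset.sum_filter_add_sum_filter_not _ (fun d : α →₀ ℕ => d w = 0)]
  congr 1
  symm
  refine Finset.sum_bij (fun d _ => d + Finsupp.single w 1) ?_ ?_ ?_ (fun _ _ => rfl)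
  · intro d hd
    rw [Finset.mem_filter, Finset.mem_Iic]
    exact ⟨add_le_add_left (Finset.mem_Iic.1 hd) _, by simp⟩
  · intro d _ d' _ h
    exact add_right_cancel h
  · intro d hd
    rw [Finset.mem_filter, Finset.mem_Iic] at hd
    have hle : Finsupp.single w 1 ≤ d :=
      Finsupp.single_le_iff.2 (Nat.one_le_iff_ne_zero.2 hd.2)
    refine ⟨d - Finsupp.single w 1, ?_, tsub_add_cancel_of_le hle⟩
    rw [Finset.mem_Iic]
    exact tsub_le_iff_right.2 hd.1

variable (K) (hle : x' ≤ x) (iR : Fin n) (hyr : y iR ≤ x) (yb : Pmx P n y x')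

/-- The term `(t^d | α)`, where `α` is the monomial with exponent `p`. -/
def shiftTerm (p : EIdx P n y x) (d : Pmx P n y x →₀ ℕ) : ExMod K P n y x' :=
  shiftCoeff p.2 d • exMonomial K P n y x' (transportIdx hle iR hyr yb (p + shiftIdx d))

/-- The sum of the terms `(t^d | α)`, where `α` is the monomial with exponent `p`. -/
def shiftSum (p : EIdx P n y x) : ExMod K P n y x' :=
  ∑ d ∈ Finset.Iic (Bnd P n y x x' iR hyr p.1), shiftTerm K hle iR hyr yb p d

variable {K hle iR hyr yb}

lemma shiftSum_eq_zero {p : EIdx P n y x} {w : Pmx P n y x} (hw : 0 < p.2 w) :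
    shiftSum K hle iR hyr yb p = 0 :=
  Finset.sum_eq_zero fun d _ => by rw [shiftTerm, shiftCoeff_eq_zero hw, zero_smul]

lemma shiftTerm_eq_zero (hyb : yb.1 = y iR) (p : EIdx P n y x) {d : Pmx P n y x →₀ ℕ}
    {z : Pmx P n y x} (hz : y iR ≤ z.1) (hd : (-(p.1 ⟨iR, hyr⟩)).toNat < d z) :
    shiftTerm K hle iR hyr yb p d = 0 := by
  rw [shiftTerm, exMonomial_eq_zero (w := yb), smul_zero]
  rw [transportIdx_snd_self hyb, Prod.fst_add, Finsupp.add_apply, shiftIdx_fst]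
  have h := Finset.single_le_sum (f := fun z : Pmx P n y x =>
    (d z : ℤ) * (if y iR ≤ z.1 then 1 else 0)) (fun w _ => by positivity) (Finset.mem_univ z)
  simp only [if_pos hz, mul_one] at h
  change 0 < _ + ∑ z : Pmx P n y x, (d z : ℤ) * (if y iR ≤ z.1 then 1 else 0)
  omega

lemma sum_shiftTerm (hyb : yb.1 = y iR) (hZ : ∀ z ≤ x, ¬ z ≤ x' → y iR ≤ z)
    (p : EIdx P n y x) {B : Pmx P n y x →₀ ℕ} (hB : ∀ z, B z ≠ 0 → z.1 ≤ x ∧ ¬ z.1 ≤ x')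
    (h : Bnd P n y x x' iR hyr p.1 ≤ B) :
    ∑ d ∈ Finset.Iic B, shiftTerm K hle iR hyr yb p d = shiftSum K hle iR hyr yb p := by
  symm
  refine Finset.sum_subset (Finset.Iic_subset_Iic.2 h) fun d hd hd' => ?_
  rw [Finset.mem_Iic, Finsupp.le_def] at hd'
  push Not at hd'
  obtain ⟨z, hz⟩ := hd'
  have hz' := hB z (ne_zero_of_mem_Iic hd (Nat.ne_zero_of_lt hz))
  rw [Bnd_apply, if_pos hz'] at hz
  exact shiftTerm_eq_zero hyb p (hZ z.1 hz'.1 hz'.2) hz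

lemma shiftTerm_add_single (hyb : yb.1 = y iR) (p : EIdx P n y x) {d : Pmx P n y x →₀ ℕ}
    {w : Pmx P n y x} (hd : d w = 0) :
    shiftTerm K hle iR hyr yb (p + (0, Finsupp.single w 1)) d =
      shiftCoeff p.2 d • exMonomial K P n y x'
        (transportIdx hle iR hyr yb (p + (0, Finsupp.single w 1) + shiftIdx d)) := by
  rw [shiftTerm, Prod.snd_add]
  by_cases hq : p.2 w = 0
  · rw [exMonomial_eq_zero (w := pmxEmb P n y x x' hle w), smul_zero, smul_zero]
    rw [transportIdx_snd_pmxEmb hyb, Prod.snd_add, Prod.snd_add, Finsupp.add_apply,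
      Finsupp.add_apply, shiftIdx_snd, hd, hq, Finsupp.single_eq_same]
    norm_num
  · rw [shiftCoeff_add_single p.2 hd hq]

lemma shiftTerm_pascal (p : EIdx P n y x) (d : Pmx P n y x →₀ ℕ) (w : Pmx P n y x) :
    shiftCoeff p.2 (d + Finsupp.single w 1) • exMonomial K P n y x'
        (transportIdx hle iR hyr yb
          (p + (0, Finsupp.single w 1) + shiftIdx (d + Finsupp.single w 1))) =
      shiftTerm K hle iR hyr yb (p + (dvec P n y x w.1, 0)) d +
        shiftTerm K hle iR hyr yb (p + (0, Finsupp.single w 1)) (d + Finsupp.single w 1) := by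
  have h : p + (dvec P n y x w.1, 0) + shiftIdx d =
      p + (0, Finsupp.single w 1) + shiftIdx (d + Finsupp.single w 1) := by
    rw [add_assoc, add_assoc, add_comm _ (shiftIdx d), ← shiftIdx_add_single, add_comm (0, _)]
  rw [shiftTerm, shiftTerm, h, Prod.snd_add, Prod.snd_add, add_zero, shiftCoeff_pascal, add_smul]

lemma X_smul_shiftSum (hy : AtomEnum P n y) (hn : ¬ y iR ≤ x')
    (hi : ∀ i, y i ≤ x → i = iR ∨ y i ≤ x') (hyb : yb.1 = y iR)
    (hZ : ∀ z ≤ x, ¬ z ≤ x' → y iR ≤ z) (z : Pstar P) (p : EIdx P n y x) :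
    (X z : FaceS K P) • shiftSum K hle iR hyr yb p =
      (if z.1 ≤ x then shiftSum K hle iR hyr yb (p + (dvec P n y x z.1, 0)) else 0) +
      (if h : ∃ i : Fin n, y i ≤ x ∧ y i = z.1 then 0
        else shiftSum K hle iR hyr yb (p + (0, Finsupp.single ⟨z.1, z.2, h⟩ 1))) := by
  have hdvec : shiftSum K hle iR hyr yb (p + (dvec P n y x z.1, 0)) =
      ∑ d ∈ Finset.Iic (Bnd P n y x x' iR hyr p.1),
        shiftTerm K hle iR hyr yb (p + (dvec P n y x z.1, 0)) d := by
    symm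
    apply sum_shiftTerm hyb hZ
    · exact fun _ => Bnd_apply_ne_zero
    · rw [Prod.fst_add]
      exact Bnd_add_dvec_le iR hyr p.1 z.1
  have hX : ∀ d, (X z : FaceS K P) • shiftTerm K hle iR hyr yb p d =
      shiftCoeff p.2 d • ((X z : FaceS K P) •
        exMonomial K P n y x' (transportIdx hle iR hyr yb (p + shiftIdx d))) := fun d =>
    smul_comm _ _ _
  by_cases h : ∃ i : Fin n, y i ≤ x ∧ y i = z.1
  · rw [dif_pos h, add_zero]
    obtain ⟨i, hix, hiz⟩ := h
    rw [if_pos (hiz ▸ hix), hdvec, shiftSum, Finset.smul_sum]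
    refine Finset.sum_congr rfl fun d _ => ?_
    rw [hX, X_smul_exMonomial, shiftTerm, Prod.snd_add, add_zero, add_right_comm p,
      map_add _ (p + _)]
    congr 1
    by_cases hir : i = iR
    · subst hir
      rw [if_neg (hiz ▸ hn), dif_neg, zero_add, transportIdx_dvec_atom hy hn hiz]
      · have hv : ∀ v : Pmx P n y x', v = yb →
            exMonomial K P n y x' (transportIdx hle i hyr yb (p + shiftIdx d) +
              (0, Finsupp.single v 1)) =
            exMonomial K P n y x' (transportIdx hle i hyr yb (p + shiftIdx d) +
              (0, Finsupp.single yb 1)) := by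
          rintro _ rfl
          rfl
        exact hv _ (Subtype.ext (hiz.symm.trans hyb.symm))
      · rintro ⟨j, hj, hjz⟩
        exact hn (by rw [hiz, ← hjz]; exact hj)
    · have hix' := (hi i hix).resolve_left hir
      rw [if_pos (hiz ▸ hix'), dif_pos ⟨i, hix', hiz⟩, add_zero, transportIdx_dvec]
      rw [← hiz]
      exact fun h => hir (hy.eq_of_le h).symm
  · have h' : ¬ ∃ i : Fin n, y i ≤ x' ∧ y i = z.1 := fun ⟨i, h1, h2⟩ => h ⟨i, h1.trans hle, h2⟩
    set w : Pmx P n y x := ⟨z.1, z.2, h⟩ with hw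
    rw [dif_neg h]
    have hX' : ∀ d, (X z : FaceS K P) • shiftTerm K hle iR hyr yb p d =
        (if z.1 ≤ x' then shiftTerm K hle iR hyr yb (p + (dvec P n y x z.1, 0)) d else 0) +
          shiftCoeff p.2 d • exMonomial K P n y x' (transportIdx hle iR hyr yb
            (p + (0, Finsupp.single w 1) + shiftIdx d)) := by
      intro d
      rw [hX, X_smul_exMonomial, dif_neg h', smul_add, add_right_comm p, map_add _ (p + _),
        transportIdx_single]
      congr 1
      split_ifs with hzx'
      · rw [shiftTerm, Prod.snd_add, add_zero, add_right_comm p, map_add _ (p + _),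
          transportIdx_dvec fun h => hn (h.trans hzx')]
      · rw [smul_zero]
    by_cases hzZ : z.1 ≤ x ∧ ¬ z.1 ≤ x'
    · have hB : ∀ v : Pmx P n y x,
          (Bnd P n y x x' iR hyr p.1 + Finsupp.single w 1 : Pmx P n y x →₀ ℕ) v ≠ 0 →
          v.1 ≤ x ∧ ¬ v.1 ≤ x' := by
        intro v hv
        by_cases hvw : w = v
        · exact hvw ▸ hzZ
        · rw [Finsupp.add_apply, Finsupp.single_eq_of_ne' hvw, add_zero] at hv
          exact Bnd_apply_ne_zero hv
      have hBle : Bnd P n y x x' iR hyr p.1 ≤ Bnd P n y x x' iR hyr p.1 + Finsupp.single w 1 :=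
        le_self_add
      rw [if_pos hzZ.1, hdvec, ← sum_shiftTerm hyb hZ p hB hBle,
        ← sum_shiftTerm hyb hZ (p + (0, Finsupp.single w 1)) hB
          (by rwa [Prod.fst_add, add_zero]), Finset.smul_sum,
        Finset.sum_congr rfl fun d _ => hX' d]
      simp only [if_neg hzZ.2, zero_add]
      rw [sum_Iic_add_single, sum_Iic_add_single, add_left_comm, ← Finset.sum_add_distrib]
      refine congrArg₂ _ (Finset.sum_congr rfl fun d hd => ?_)
        (Finset.sum_congr rfl fun d _ => shiftTerm_pascal p d w)
      exact (shiftTerm_add_single hyb p (Finset.mem_filter.1 hd).2).symm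
    · have hterm : ∀ d ∈ Finset.Iic (Bnd P n y x x' iR hyr p.1),
          (X z : FaceS K P) • shiftTerm K hle iR hyr yb p d =
          (if z.1 ≤ x then shiftTerm K hle iR hyr yb (p + (dvec P n y x z.1, 0)) d else 0) +
            shiftTerm K hle iR hyr yb (p + (0, Finsupp.single w 1)) d := by
        intro d hd
        have hdw : d w = 0 := by
          by_contra hdw
          exact hzZ (Bnd_apply_ne_zero (ne_zero_of_mem_Iic hd hdw))
        rw [hX', shiftTerm_add_single hyb p hdw]
        exact congrArg₂ _ (if_congr
          ⟨fun h => h.trans hle, fun h => by_contra fun h' => hzZ ⟨h, h'⟩⟩ rfl rfl) rfl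
      rw [hdvec, shiftSum, Finset.smul_sum, Finset.sum_congr rfl hterm, Finset.sum_add_distrib]
      congr 1
      · split_ifs <;> simp
      · rw [shiftSum, Prod.fst_add, add_zero]

lemma eExp_eq (a : BelowIx P n y x →₀ ℤ) (d : Pmx P n y x →₀ ℕ) (i : BelowIx P n y x) :
    eExp P n y x a d i.1 = a i + (shiftIdx d).1 i := by
  rw [eExp, dif_pos i.2, shiftIdx_fst]
  congr 1
  refine Finset.sum_subset (Finset.subset_univ _) fun z _ hz => ?_
  rw [Finsupp.notMem_support_iff.1 hz, Nat.cast_zero, zero_mul]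

lemma shiftCoeff_neg (b d : Pmx P n y x →₀ ℕ) :
    shiftCoeff (-Finsupp.mapRange (Nat.cast : ℕ → ℤ) Nat.cast_zero b) d =
      ∏ z ∈ b.support ∪ d.support, Nat.choose (b z + d z) (b z) := by
  have h : ∀ z, negChoose (-(b z : ℤ)) (d z) = Nat.choose (b z + d z) (b z) := fun z => by
    simp [negChoose]
  rw [shiftCoeff]
  refine (Finset.prod_congr rfl fun z _ => h z).trans
    (Finset.prod_subset (Finset.subset_univ _) fun z _ hz => ?_).symm
  rw [Finset.notMem_union, Finsupp.notMem_support_iff] at hz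
  rw [hz.1, Nat.choose_zero_right]

lemma shiftTerm_mIdx (hyb : yb.1 = y iR) (a : BelowIx P n y x →₀ ℤ)
    (b d : Pmx P n y x →₀ ℕ) :
    shiftTerm K hle iR hyr yb (mIdx P n y x a b) d =
      targetMono K P n y x x' hle iR yb a b d := by
  have he := eExp_eq a d ⟨iR, hyr⟩
  rw [targetMono, shiftTerm]
  split_ifs with h
  · rw [exMonomial_eq_zero (w := yb), smul_zero]
    rw [transportIdx_snd_self hyb]
    exact h.trans_eq he
  · refine congrArg₂ _ (shiftCoeff_neg b d) ?_
    refine congrArg (exMonomial K P n y x') (Prod.ext ?_ ?_)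
    · ext i
      exact (eExp_eq a d ⟨i.1, i.2.trans hle⟩).symm
    · ext v
      by_cases hv : v = yb
      · subst hv
        rw [transportIdx_snd_self hyb]
        refine he.symm.trans ?_
        change eExp P n y x a d iR = -((_ : ℕ) : ℤ)
        rw [Finsupp.add_apply, Finsupp.embDomain_of_notMem_range, Finsupp.single_eq_same]
        · omega
        · rintro ⟨w, hw⟩
          exact pmxEmb_ne hyb hyr w hw
      · by_cases hv' : v ∈ Set.range (pmxEmb P n y x x' hle)
        · obtain ⟨w, rfl⟩ := hv'
          rw [transportIdx_snd_pmxEmb hyb]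
          change -(b w : ℤ) + -(d w : ℤ) = -((_ : ℕ) : ℤ)
          rw [Finsupp.add_apply, Finsupp.embDomain_apply_self, Finsupp.single_eq_of_ne hv,
            Finsupp.add_apply]
          push_cast
          ring
        · rw [transportIdx_snd, Finsupp.add_apply, Finsupp.mapDomain_of_notMem_range _ _ hv',
            Finsupp.single_eq_of_ne hv]
          change 0 + 0 = -((_ : ℕ) : ℤ)
          rw [Finsupp.add_apply, Finsupp.embDomain_of_notMem_range _ _ _ hv',
            Finsupp.single_eq_of_ne hv]
          rfl

lemma gdeg_transportIdx_add_shiftIdx (hy : AtomEnum P n y) (hn : ¬ y iR ≤ x')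
    (hi : ∀ i, y i ≤ x → i = iR ∨ y i ≤ x') (hyb : yb.1 = y iR) (p : EIdx P n y x)
    {d : Pmx P n y x →₀ ℕ} (hd : d ∈ Finset.Iic (Bnd P n y x x' iR hyr p.1)) :
    gdeg P n y x' (transportIdx hle iR hyr yb (p + shiftIdx d)) = gdeg P n y x p := by
  rw [gdeg_transportIdx hy hn hi hyb, gdeg_add_shiftIdx]
  exact fun z hz => (Bnd_apply_ne_zero (ne_zero_of_mem_Iic hd hz)).1

lemma shiftSum_mem_ExGrade (hy : AtomEnum P n y) (hn : ¬ y iR ≤ x')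
    (hi : ∀ i, y i ≤ x → i = iR ∨ y i ≤ x') (hyb : yb.1 = y iR) (p : EIdx P n y x) :
    shiftSum K hle iR hyr yb p ∈ ExGrade K P n y x' (gdeg P n y x p) :=
  Submodule.sum_mem _ fun _ hd => Submodule.smul_of_tower_mem _ _ <| Submodule.subset_span
    ⟨_, gdeg_transportIdx_add_shiftIdx hy hn hi hyb p hd, rfl⟩

lemma shiftSum_mem_cleanL (hy : AtomEnum P n y) (hn : ¬ y iR ≤ x')
    (hi : ∀ i, y i ≤ x → i = iR ∨ y i ≤ x') (hyb : yb.1 = y iR)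
    (a : BelowIx P n y x →₀ ℤ) {b : Pmx P n y x →₀ ℕ} (hb : b ≠ 0)
    (hdeg : ∀ i, 0 ≤ gdeg P n y x (mIdx P n y x a b) i) :
    shiftSum K hle iR hyr yb (mIdx P n y x a b) ∈ cleanL K P n y x' := by
  refine Submodule.sum_mem _ fun d hd => Submodule.smul_of_tower_mem _ _ ?_
  have hg := gdeg_transportIdx_add_shiftIdx (hle := hle) hy hn hi hyb _ hd
  set q := transportIdx hle iR hyr yb (mIdx P n y x a b + shiftIdx d) with hq
  by_cases h : ∃ v, 0 < q.2 v
  · rw [exMonomial_eq_zero h.choose_spec]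
    exact Submodule.zero_mem _
  push Not at h
  have hqm : q = mIdx P n y x' q.1 (Finsupp.mapRange (fun k : ℤ => (-k).toNat) rfl q.2) := by
    refine Prod.ext rfl (Finsupp.ext fun v => ?_)
    change q.2 v = -(((-q.2 v).toNat : ℕ) : ℤ)
    have := h v
    omega
  refine Submodule.subset_span ⟨q.1, _, fun h0 => hb (Finsupp.ext fun w => ?_), fun i => ?_,
    congrArg (exMonomial K P n y x') hqm⟩
  · have h1 := DFunLike.congr_fun h0 (pmxEmb P n y x x' hle w)
    rw [Finsupp.mapRange_apply, hq, transportIdx_snd_pmxEmb hyb] at h1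
    change (-(-(b w : ℤ) + -(d w : ℤ))).toNat = 0 at h1
    change b w = 0
    omega
  · rw [← hqm, hg]
    exact hdeg i

end ShiftSum

end CoverMap

/-- Proposition 3.11: for a covering pair `x' ⋖ x`, the
`K`-linear map `ψ : *E_x → *E_{x'}` defined on basis monomials by
`ψ(α) = ∑_{d ∈ ℕ^Z} (t_Z^d | α)` (a finite sum) is a degree preserving
`S`-module homomorphism; consequently, `ψ` is a clean map. -/
theorem statement14
    (hP : IsSimplicialPoset P) (hy : AtomEnum P n y)
    (x x' : P) (r : ℕ) (hr : 2 ≤ r)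
    (hx : ∀ i : Fin n, y i ≤ x ↔ (i : ℕ) < r)
    (hx' : ∀ i : Fin n, y i ≤ x' ↔ (i : ℕ) < r - 1)
    (hx'0 : x' ≠ ⊥) (hcov : x' ⋖ x) (hle : x' ≤ x)
    (iR : Fin n) (hiR : (iR : ℕ) = r - 1) (hyr : y iR ≤ x)
    (yb : Pmx P n y x') (hyb : yb.1 = y iR) :
    ∃ ψ : ExMod K P n y x →ₗ[FaceS K P] ExMod K P n y x',
      (∀ a b, ψ (emono K P n y x a b) =
        ∑ d ∈ Finset.Iic (Bnd P n y x x' iR hyr a),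
          targetMono K P n y x x' hle iR yb a b d) ∧
      IsClean K P n y x x' ψ := by
  have hn : ¬ y iR ≤ x' := fun h => by have := (hx' iR).1 h; omega
  have hi : ∀ i, y i ≤ x → i = iR ∨ y i ≤ x' := fun i h => by
    have := (hx i).1 h
    rw [hx', Fin.ext_iff]
    omega
  have hZ : ∀ z ≤ x, ¬ z ≤ x' → y iR ≤ z := by
    intro z hz hzx'
    by_contra hr
    refine hzx' (hP.le_of_forall_isAtom hz hle fun u hu huz => ?_)
    obtain ⟨i, rfl⟩ := (hy.2 u).1 hu
    exact (hi i (huz.trans hz)).resolve_left fun h => hr (h ▸ huz)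
  obtain ⟨ψ, hψ⟩ := exists_linearMap_of_exMonomial (shiftSum K hle iR hyr yb)
    (fun _ _ => shiftSum_eq_zero) (X_smul_shiftSum hy hn hi hyb hZ)
  refine ⟨ψ, fun a b => ?_, fun aa e he => ?_, fun e he => ?_⟩
  · exact (hψ _).trans (Finset.sum_congr rfl fun d _ => shiftTerm_mIdx hyb a b d)
  · refine (Submodule.span_le (p := (ExGrade K P n y x' aa).comap (ψ.restrictScalars K))).2 ?_ he
    rintro _ ⟨p, rfl, rfl⟩
    change ψ (exMonomial K P n y x p) ∈ ExGrade K P n y x' (gdeg P n y x p)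
    rw [hψ]
    exact shiftSum_mem_ExGrade hy hn hi hyb p
  · refine (Submodule.span_le (p := (cleanL K P n y x').comap (ψ.restrictScalars K))).2 ?_ he
    rintro _ ⟨a, b, hb, hdeg, rfl⟩
    change ψ (exMonomial K P n y x (mIdx P n y x a b)) ∈ cleanL K P n y x'
    rw [hψ]
    exact shiftSum_mem_cleanL hy hn hi hyb a hb hdeg

end
end
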